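/- arXiv:1505.01337 — 4 statements merged into one kernel-verified Lean document; each statement's English description precedes it below -/
import Mathlib

section
/- Let R₁ and R₂ be binary relations on a set α, let ≿ and ≻ be binary relations on α such that ≻ is irreflexive and ≿ is compatible with ≻ (i.e., a ≿ b and b ≻ c imply a ≻ c), and suppose that the inverse of R₁ and R₂ are both contained in ≿ (i.e., R₁ s t implies t ≿ s, and R₂ s t implies s ≿ t). If t₁ ≻ t₂, then t₁ and t₂ are not joinable with respect to (R₁, R₂): there is no u with t₁ →R₁* u and t₂ →R₂* u. -/
/-- Discrimination pairs (Theorem 2): if `≻` is irreflexive, `≿ ∘ ≻ ⊆ ≻`,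
`R₁⁻¹ ∪ R₂ ⊆ ≿`, and `t₁ ≻ t₂`, then `t₁` and `t₂` are not joinable w.r.t. `(R₁, R₂)`. -/
theorem discrimination_pair_nonjoinable {α : Type*}
    (R₁ R₂ : α → α → Prop) (ge gt : α → α → Prop)
    (hirr : ∀ a, ¬ gt a a)
    (hcomp : ∀ a b c, ge a b → gt b c → gt a c)
    (hR₁ : ∀ s t, R₁ s t → ge t s)
    (hR₂ : ∀ s t, R₂ s t → ge s t)
    (t₁ t₂ : α) (h : gt t₁ t₂) :
    ¬ ∃ u, Relation.ReflTransGen R₁ t₁ u ∧ Relation.ReflTransGen R₂ t₂ u := by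
  rintro ⟨u, h1, h2⟩
  have hu : gt u t₂ := by
    clear h2
    induction h1 with
    | refl => exact h
    | tail _ hbc ih => exact hcomp _ _ _ (hR₁ _ _ hbc) ih
  have key : ∀ x, Relation.ReflTransGen R₂ x u → gt x t₂ := by
    intro x hx
    induction hx using Relation.ReflTransGen.head_induction_on with
    | refl => exact hu
    | head hab _ ih => exact hcomp _ _ _ (hR₂ _ _ hab) ih
  exact hirr _ (key _ h2)
end

section
/- Let R₁ and R₂ be binary relations on a set α, and let (≿, ≻) be relations on α such that ≻ is well-founded and a ≿ b together with b ≻ c implies a ≻ c. Suppose R₁ s t implies t ≿ s and R₂ s t implies s ≿ t, for all s, t. If t₁ ≻ t₂, then there is no u with t₁ →R₁* u and t₂ →R₂* u. -/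
/-- Every reduction pair is a discrimination pair: if `≻` is well-founded
(no infinite descending chains), compatible with `≿`, and `R₁⁻¹ ∪ R₂ ⊆ ≿`,
then `t₁ ≻ t₂` implies non-joinability of `t₁` and `t₂` w.r.t. `(R₁, R₂)`. -/
theorem reduction_pair_nonjoinable {α : Type*}
    (R₁ R₂ : α → α → Prop) (ge gt : α → α → Prop)
    (hwf : WellFounded (fun a b => gt b a))
    (hcomp : ∀ a b c, ge a b → gt b c → gt a c)
    (hR₁ : ∀ s t, R₁ s t → ge t s)
    (hR₂ : ∀ s t, R₂ s t → ge s t)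
    (t₁ t₂ : α) (h : gt t₁ t₂) :
    ¬ ∃ u, Relation.ReflTransGen R₁ t₁ u ∧ Relation.ReflTransGen R₂ t₂ u := by
  rintro ⟨u, h1, h2⟩
  have hu : gt u t₂ := by
    clear h2
    induction h1 with
    | refl => exact h
    | tail _ hbc ih => exact hcomp _ _ _ (hR₁ _ _ hbc) ih
  have key : ∀ c, gt u c → gt t₂ c := by
    intro c hc
    clear hu h h1
    induction h2 using Relation.ReflTransGen.head_induction_on with
    | refl => exact hc
    | head hab _ ih => exact hcomp _ _ _ (hR₂ _ _ hab) ih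
  exact hwf.irrefl.irrefl _ (key _ hu)
end

section
/- Let R₁ and R₂ be binary relations on a set α, let A be a type equipped with a partial order ≥, and let f : α → A be such that for all s, t: R₁ s t implies f t ≥ f s, and R₂ s t implies f s ≥ f t. If ¬(f t₂ ≥ f t₁), then there is no u with t₁ →R₁* u and t₂ →R₂* u. -/
/-- Theorem 4 (interpretations/quasi-models): if `f` maps every `R₁`-step
`s → t` to `f t ≥ f s` and every `R₂`-step `s → t` to `f s ≥ f t`, and
`¬ (f t₂ ≥ f t₁)`, then `t₁` and `t₂` are not joinable w.r.t. `(R₁, R₂)`. -/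
theorem quasi_model_nonjoinable {α : Type*} {A : Type*} [PartialOrder A]
    (R₁ R₂ : α → α → Prop) (f : α → A)
    (hR₁ : ∀ s t, R₁ s t → f t ≥ f s)
    (hR₂ : ∀ s t, R₂ s t → f s ≥ f t)
    (t₁ t₂ : α) (h : ¬ f t₂ ≥ f t₁) :
    ¬ ∃ u, Relation.ReflTransGen R₁ t₁ u ∧ Relation.ReflTransGen R₂ t₂ u := by
  rintro ⟨u, h1, h2⟩
  have a : f t₁ ≤ f u := by
    clear h2
    induction h1 with
    | refl => exact le_rfl
    | tail _ hs ih => exact le_trans ih (hR₁ _ _ hs)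
  have b : f u ≤ f t₂ := by
    clear h1 a
    induction h2 with
    | refl => exact le_rfl
    | tail _ hs ih => exact le_trans (hR₂ _ _ hs) ih
  exact h (le_trans a b)
end

section
/- Let α be a four-element type with distinct elements a, b, c, d. Let R be the relation with exactly the pairs R a b and R a c, and let S be the relation with S x d for every x ∈ α. Then: (1) R is not confluent, i.e., there exist s, t₁, t₂ with s →R* t₁ and s →R* t₂ such that no u satisfies t₁ →R* u and t₂ →R* u; and (2) the union R ∪ S is confluent, i.e., whenever s →(R∪S)* t₁ and s →(R∪S)* t₂ there exists u with t₁ →(R∪S)* u and t₂ →(R∪S)* u. -/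
/-- Counterexample (from Theorem 6's discussion): on a four-element type
`{a, b, c, d}`, the relation `R = {(a,b), (a,c)}` is not confluent, but
`R ∪ S` with `S = {(x,d) | x}` (the collapsing rule `x → d`) is confluent. -/
theorem modularity_counterexample {α : Type*} (a b c d : α)
    (hab : a ≠ b) (hac : a ≠ c) (had : a ≠ d) (hbc : b ≠ c) (hbd : b ≠ d)
    (hcd : c ≠ d) (hall : ∀ x : α, x = a ∨ x = b ∨ x = c ∨ x = d)
    (R S : α → α → Prop)
    (hR : ∀ x y, R x y ↔ (x = a ∧ y = b) ∨ (x = a ∧ y = c))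
    (hS : ∀ x y, S x y ↔ y = d) :
    (¬ ∀ s t₁ t₂, Relation.ReflTransGen R s t₁ → Relation.ReflTransGen R s t₂ →
        ∃ u, Relation.ReflTransGen R t₁ u ∧ Relation.ReflTransGen R t₂ u) ∧
    (∀ s t₁ t₂, Relation.ReflTransGen (fun x y => R x y ∨ S x y) s t₁ →
        Relation.ReflTransGen (fun x y => R x y ∨ S x y) s t₂ →
        ∃ u, Relation.ReflTransGen (fun x y => R x y ∨ S x y) t₁ u ∧
             Relation.ReflTransGen (fun x y => R x y ∨ S x y) t₂ u) := by
  have key : ∀ x u, x ≠ a → Relation.ReflTransGen R x u → x = u := by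
    intro x u hx h
    rcases Relation.ReflTransGen.cases_head h with h | ⟨y, h, _⟩
    · exact h
    · rcases (hR _ _).1 h with h | h
      · exact absurd h.1 hx
      · exact absurd h.1 hx
  refine ⟨fun h => ?_, fun s t₁ t₂ _ _ => ⟨d, ?_, ?_⟩⟩
  · obtain ⟨u, h1, h2⟩ := h a b c
      (Relation.ReflTransGen.single ((hR _ _).2 (Or.inl ⟨rfl, rfl⟩)))
      (Relation.ReflTransGen.single ((hR _ _).2 (Or.inr ⟨rfl, rfl⟩)))
    exact hbc ((key b u hab.symm h1).trans (key c u hac.symm h2).symm)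
  · exact Relation.ReflTransGen.single (Or.inr ((hS _ _).2 rfl))
  · exact Relation.ReflTransGen.single (Or.inr ((hS _ _).2 rfl))
end
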